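/- arXiv:2110.06557 — 2 statements merged into one kernel-verified Lean document; each statement's English description precedes it below -/
import Mathlib

section
/- Let E be a finite-dimensional real normed vector space, let L : E → E be a C^∞ map, define ℒ_t(Q) := DL(Q)[L(Q)], and let Q : ℝ → E solve Q'(t) = L(Q(t)) on a neighborhood of t_n with Q^n := Q(t_n). For Δt > 0 define the explicit two-stage update Q* := Q^n + (Δt/2) L(Q^n) + (Δt²/8) ℒ_t(Q^n) and Q^{n+1} := Q^n + Δt L(Q^n) + (Δt²/6)( ℒ_t(Q^n) + 2 ℒ_t(Q*) ). Then the scheme is fourth-order accurate: there exist C > 0 and δ > 0 such that ‖Q^{n+1} − Q(t_n + Δt)‖ ≤ C Δt⁵ for all Δt ∈ (0, δ). -/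
open scoped Topology

lemma aux_int {E : Type*} [NormedAddCommGroup E] [NormedSpace ℝ E]
    (f f' : ℝ → E) (n : ℕ) (hd : ∀ᶠ t in 𝓝 (0:ℝ), HasDerivAt f (f' t) t)
    (h0 : f 0 = 0) (hO : f' =O[𝓝 0] fun t : ℝ => t ^ n) :
    f =O[𝓝 0] fun t : ℝ => t ^ (n + 1) := by
  obtain ⟨C, hC⟩ := hO.bound
  obtain ⟨ε, hε, hb⟩ := Metric.eventually_nhds_iff_ball.1 (hd.and hC)
  refine Asymptotics.IsBigO.of_bound C ?_
  filter_upwards [Metric.ball_mem_nhds (0:ℝ) hε] with t ht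
  have hC0 : ∀ s ∈ Metric.closedBall (0:ℝ) |t|, s ∈ Metric.ball (0:ℝ) ε := by
    intro s hs
    simp only [Metric.mem_closedBall, Metric.mem_ball, dist_zero_right, Real.norm_eq_abs] at *
    linarith
  by_cases ht0 : t = 0
  · subst ht0; simp [h0]
  have hCnn : 0 ≤ C := by
    have h1 := (hb t ht).2
    have h2 : 0 < ‖t ^ n‖ := norm_pos_iff.2 (pow_ne_zero n ht0)
    by_contra hneg
    have h3 := norm_nonneg (f' t)
    nlinarith
  have key := (convex_closedBall (0:ℝ) |t|).norm_image_sub_le_of_norm_hasDerivWithin_le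
    (f := f) (f' := f') (C := C * |t| ^ n) (x := 0) (y := t)
    (fun s hs => (hb s (hC0 s hs)).1.hasDerivWithinAt)
    (fun s hs => by
      refine (hb s (hC0 s hs)).2.trans ?_
      have : |s| ≤ |t| := by simpa using hs
      rw [norm_pow, Real.norm_eq_abs]
      gcongr)
    (by simp) (by simp)
  rw [h0, sub_zero, sub_zero] at key
  rw [norm_pow, pow_succ, Real.norm_eq_abs, ← mul_assoc]
  exact key

lemma aux_comp {E : Type*} [NormedAddCommGroup E] [NormedSpace ℝ E]
    (L F : E → E) (hF : ContDiff ℝ (⊤ : ℕ∞) F) (q : ℝ → E)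
    (hq : ∀ᶠ t in 𝓝 (0:ℝ), HasDerivAt q (L (q t)) t) :
    ∀ᶠ t in 𝓝 (0:ℝ), HasDerivAt (fun t => F (q t)) (fderiv ℝ F (q t) (L (q t))) t := by
  filter_upwards [hq] with t ht
  exact ((hF.differentiable (by simp)) (q t)).hasFDerivAt.comp_hasDerivAt t ht

lemma aux_smooth {E : Type*} [NormedAddCommGroup E] [NormedSpace ℝ E]
    (L F : E → E) (hL : ContDiff ℝ (⊤ : ℕ∞) L) (hF : ContDiff ℝ (⊤ : ℕ∞) F) :
    ContDiff ℝ (⊤ : ℕ∞) (fun x => fderiv ℝ F x (L x)) :=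
  (hF.fderiv_right (m := (⊤ : ℕ∞)) (by simp)).clm_apply hL

lemma aux_pow (m n : ℕ) (h : m ≤ n) :
    (fun t : ℝ => t ^ n) =O[𝓝 0] fun t : ℝ => t ^ m := by
  obtain ⟨k, rfl⟩ := Nat.exists_eq_add_of_le h
  have : (fun t : ℝ => t ^ k) =O[𝓝 0] fun _ => (1:ℝ) :=
    (show ContinuousAt (fun t : ℝ => t ^ k) 0 by fun_prop).isBigO_one ℝ
  simpa [pow_add] using (Asymptotics.isBigO_refl (fun t : ℝ => t ^ m) (𝓝 0)).mul this

lemma aux_mono {E : Type*} [NormedAddCommGroup E] [NormedSpace ℝ E]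
    (m n : ℕ) (h : m ≤ n) (c : ℝ) (v : E) :
    (fun t : ℝ => (t ^ n * c) • v) =O[𝓝 0] fun t : ℝ => t ^ m := by
  have h1 : (fun _ : ℝ => c • v) =O[𝓝 (0:ℝ)] fun _ => (1:ℝ) :=
    (show ContinuousAt (fun _ : ℝ => c • v) 0 by fun_prop).isBigO_one ℝ
  simpa [mul_smul] using (aux_pow m n h).smul h1

lemma aux_taylor {E : Type*} [NormedAddCommGroup E] [NormedSpace ℝ E]
    (q g0 g1 g2 g3 g4 : ℝ → E)
    (h : ∀ᶠ t in 𝓝 (0:ℝ), HasDerivAt q (g0 t) t)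
    (h0 : ∀ᶠ t in 𝓝 (0:ℝ), HasDerivAt g0 (g1 t) t)
    (h1 : ∀ᶠ t in 𝓝 (0:ℝ), HasDerivAt g1 (g2 t) t)
    (h2 : ∀ᶠ t in 𝓝 (0:ℝ), HasDerivAt g2 (g3 t) t)
    (h3 : ∀ᶠ t in 𝓝 (0:ℝ), HasDerivAt g3 (g4 t) t)
    (h4 : ContinuousAt g4 0) :
    (fun t => g1 t - (g1 0 + t • g2 0 + (t ^ 2 / 2) • g3 0)) =O[𝓝 0] (fun t : ℝ => t ^ 3) ∧
    (fun t => q t - (q 0 + t • g0 0 + (t ^ 2 / 2) • g1 0 + (t ^ 3 / 6) • g2 0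
      + (t ^ 4 / 24) • g3 0)) =O[𝓝 0] (fun t : ℝ => t ^ 5) := by
  have p1 (t : ℝ) (v : E) : HasDerivAt (fun t : ℝ => t • v) v t := by
    simpa using (hasDerivAt_id t).smul_const v
  have p2 (t : ℝ) (v : E) : HasDerivAt (fun t : ℝ => (t ^ 2 / 2) • v) (t • v) t := by
    convert ((hasDerivAt_pow 2 t).div_const 2).smul_const v using 2
    norm_num
  have p3 (t : ℝ) (v : E) : HasDerivAt (fun t : ℝ => (t ^ 3 / 6) • v) ((t ^ 2 / 2) • v) t := by
    convert ((hasDerivAt_pow 3 t).div_const 6).smul_const v using 2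
    norm_num; ring
  have p4 (t : ℝ) (v : E) : HasDerivAt (fun t : ℝ => (t ^ 4 / 24) • v) ((t ^ 3 / 6) • v) t := by
    convert ((hasDerivAt_pow 4 t).div_const 24).smul_const v using 2
    norm_num; ring
  have e4 : g4 =O[𝓝 0] (fun t : ℝ => t ^ 0) := by
    simpa using h4.isBigO_one ℝ
  have e3 := aux_int (fun t => g3 t - g3 0) g4 0
    (h3.mono fun t ht => ht.sub_const _) (by simp) e4
  have e2 := aux_int (fun t => g2 t - (g2 0 + t • g3 0)) _ 1
    (h2.mono fun t ht => ht.sub ((p1 t _).const_add _)) (by simp) e3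
  have e1 := aux_int (fun t => g1 t - (g1 0 + t • g2 0 + (t ^ 2 / 2) • g3 0)) _ 2
    (h1.mono fun t ht => ht.sub (((p1 t _).const_add _).add (p2 t _))) (by simp) e2
  have e0 := aux_int (fun t => g0 t - (g0 0 + t • g1 0 + (t ^ 2 / 2) • g2 0
      + (t ^ 3 / 6) • g3 0)) _ 3
    (h0.mono fun t ht => ht.sub ((((p1 t _).const_add _).add (p2 t _)).add (p3 t _)))
    (by simp) e1
  have e := aux_int (fun t => q t - (q 0 + t • g0 0 + (t ^ 2 / 2) • g1 0 + (t ^ 3 / 6) • g2 0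
      + (t ^ 4 / 24) • g3 0)) _ 4
    (h.mono fun t ht => ht.sub (((((p1 t _).const_add _).add (p2 t _)).add (p3 t _)).add (p4 t _)))
    (by simp) e0
  exact ⟨e1, e⟩

/-- Fourth-order accuracy of the explicit two-stage scheme for `Q' = L(Q)`. -/
theorem two_stage_explicit_fourth_order
    {E : Type*} [NormedAddCommGroup E] [NormedSpace ℝ E] [FiniteDimensional ℝ E]
    (L : E → E) (hL : ContDiff ℝ (⊤ : ℕ∞) L)
    (Lt : E → E) (hLt : ∀ Q, Lt Q = fderiv ℝ L Q (L Q))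
    (Q : ℝ → E) (tn : ℝ)
    (hQ : ∀ᶠ t in 𝓝 tn, HasDerivAt Q (L (Q t)) t)
    (Qn : E) (hQn : Qn = Q tn) :
    ∃ C > 0, ∃ δ > 0, ∀ Δt ∈ Set.Ioo (0:ℝ) δ,
      ‖(Qn + Δt • L Qn
          + (Δt ^ 2 / 6) • (Lt Qn
            + (2:ℝ) • Lt (Qn + (Δt / 2) • L Qn + (Δt ^ 2 / 8) • Lt Qn)))
        - Q (tn + Δt)‖ ≤ C * Δt ^ 5 := by
  obtain rfl : Lt = fun x => fderiv ℝ L x (L x) := funext hLt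
  set G : E → E := fun x => fderiv ℝ L x (L x) with hG
  set q : ℝ → E := fun t => Q (tn + t) with hqdef
  have hq : ∀ᶠ t in 𝓝 (0:ℝ), HasDerivAt q (L (q t)) t := by
    have ht : Filter.Tendsto (fun t : ℝ => tn + t) (𝓝 0) (𝓝 tn) := by
      have : ContinuousAt (fun t : ℝ => tn + t) 0 := by fun_prop
      simpa [ContinuousAt] using this
    filter_upwards [ht.eventually hQ] with t h
    exact h.comp_const_add tn t
  have hq0 : q 0 = Qn := by simp [hqdef, hQn]
  have sG : ContDiff ℝ (⊤ : ℕ∞) G := aux_smooth L L hL hL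
  have s3 := aux_smooth L G hL sG
  have s4 := aux_smooth L _ hL s3
  have s5 := aux_smooth L _ hL s4
  have cq : ContinuousAt q 0 := hq.self_of_nhds.continuousAt
  obtain ⟨e1, e⟩ := aux_taylor q _ _ _ _ _ hq (aux_comp L L hL q hq) (aux_comp L G sG q hq)
    (aux_comp L _ s3 q hq) (aux_comp L _ s4 q hq)
    (ContinuousAt.comp (f := q) s5.continuous.continuousAt cq)
  simp only [hq0] at e1 e
  change (fun t => G (q t) - (G Qn + _ + _)) =O[𝓝 0] _ at e1
  change (fun t => q t - (Qn + t • L Qn + (t ^ 2 / 2) • G Qn + _ + _)) =O[𝓝 0] _ at e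
  generalize fderiv ℝ G Qn (L Qn) = a at e1 e
  generalize fderiv ℝ (fun x => fderiv ℝ G x (L x)) Qn (L Qn) = b at e1 e
  -- half step
  have hhalf : Filter.Tendsto (fun t : ℝ => t / 2) (𝓝 0) (𝓝 0) := by
    have : ContinuousAt (fun t : ℝ => t / 2) 0 := by fun_prop
    simpa [ContinuousAt] using this
  have hpow (n : ℕ) : (fun t : ℝ => (t / 2) ^ n) =O[𝓝 0] fun t : ℝ => t ^ n := by
    refine Asymptotics.IsBigO.of_bound 1 (Filter.Eventually.of_forall fun t => ?_)
    rw [norm_pow, norm_pow, one_mul]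
    gcongr
    rw [norm_div]; norm_num
  have e1h := (e1.comp_tendsto hhalf).trans (hpow 3)
  have eh := (e.comp_tendsto hhalf).trans ((hpow 5).trans (aux_pow 3 5 (by norm_num)))
  set S : ℝ → E := fun t => Qn + (t / 2) • L Qn + (t ^ 2 / 8) • G Qn with hS
  have dS : (fun t => S t - q (t / 2)) =O[𝓝 0] fun t : ℝ => t ^ 3 := by
    have := (eh.add ((aux_mono 3 3 le_rfl (1/48) a).add
      (aux_mono 3 4 (by norm_num) (1/384) b))).neg_left
    refine this.congr_left fun t => ?_
    simp only [Function.comp, hS]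
    module
  obtain ⟨K, U, hU, hlip⟩ := (sG.of_le (m := 1) (by simp)).contDiffAt.exists_lipschitzOnWith
    (x := Qn)
  have tS : ∀ᶠ t in 𝓝 (0:ℝ), S t ∈ U := by
    have : ContinuousAt S 0 := by fun_prop
    exact this.eventually_mem (by simpa [hS] using hU)
  have tq : ∀ᶠ t in 𝓝 (0:ℝ), q (t / 2) ∈ U :=
    hhalf.eventually (cq.eventually_mem (by rwa [hq0]))
  have dG : (fun t => G (S t) - G (q (t / 2))) =O[𝓝 0] fun t : ℝ => t ^ 3 := by
    refine Asymptotics.IsBigO.trans (Asymptotics.IsBigO.of_bound K ?_) dS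
    filter_upwards [tS, tq] with t h1 h2
    exact hlip.norm_sub_le h1 h2
  have dG2 := dG.add e1h
  have main : (fun t => (Qn + t • L Qn + (t ^ 2 / 6) • (G Qn + (2:ℝ) • G (S t))) - q t)
      =O[𝓝 0] fun t : ℝ => t ^ 5 := by
    have h1 := ((aux_pow 2 2 le_rfl).const_mul_left (1/3)).smul dG2
    have h2 : (fun t : ℝ => t ^ 2 • t ^ 3) = fun t : ℝ => t ^ 5 := by
      funext t; simp only [smul_eq_mul]; ring
    rw [h2] at h1
    refine (h1.sub e).congr_left fun t => ?_
    simp only [Function.comp]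
    module
  obtain ⟨C, hC, hb⟩ := main.exists_pos
  obtain ⟨δ, hδ, hball⟩ := Metric.eventually_nhds_iff_ball.1 hb.bound
  refine ⟨C, hC, δ, hδ, fun t ht => ?_⟩
  have := hball t (by simp [abs_of_pos ht.1, ht.2])
  rwa [norm_pow, Real.norm_eq_abs, abs_of_pos ht.1] at this
end

section
/- For ρ, λ1, λ2 > 0, U, V ∈ ℝ and K1, K2 ∈ ℕ, define the modified equilibrium distribution g : ℝ × ℝ × ℝ^{K1} × ℝ^{K2} → ℝ by g(u, v, ξ1, ξ2) = ρ (λ1 λ2 / ((λ1 + λ2) π)) (λ1/π)^{K1/2} (λ2/π)^{K2/2} exp( −(λ1 λ2/(λ1 + λ2)) ((u − U)² + (v − V)²) − λ1 ‖ξ1‖² − λ2 ‖ξ2‖² ). Let ψ = (1, u, v, (1/2)(u² + v² + ‖ξ1‖² + ‖ξ2‖²)) and ψ̃ = (1, u, v, (1/2)(u² + v²), (1/2)‖ξ1‖², (1/2)‖ξ2‖²). Then the 4×6 moment matrix M with entries M_{ij} = ∫ ψ_i ψ̃_j g dΞ equals ρ times the matrix with rows: row 1 = (1, U, V, B1', K1/(4λ1),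 K2/(4λ2)); row 2 = (U, U² + 1/(2λ1) + 1/(2λ2), UV, B2', K1 U/(4λ1), K2 U/(4λ2)); row 3 = (V, UV, V² + 1/(2λ1) + 1/(2λ2), B3', K1 V/(4λ1), K2 V/(4λ2)); row 4 = (B1, B2, B3, B4, B5, B6); where B1' = (1/2)(U²+V²+1/λ1+1/λ2), B2' = (1/2)U(U²+V²+2/λ1+2/λ2), B3' = (1/2)V(U²+V²+2/λ1+2/λ2), B1 = (1/2)(U²+V²+(K1+2)/(2λ1)+(K2+2)/(2λ2)), B2 = (1/2)U(U²+V²+(K1+4)/(2λ1)+(K2+4)/(2λ2)), B3 = (1/2)V(U²+V²+(K1+4)/(2λ1)+(K2+4)/(2λ2)), B4 = (1/4)[ (U²+V²+1/λ1+1/λ2)(U²+V²+(K1+2)/(2λ1)+(K2+2)/(2λ2)) + (2/λ1+2/λ2)(U²+V²+1/(2λ1)+1/(2λ2)) ], B5 = (1/4)[ (K1/(2λ1))(U²+V²) + (K1²+4K1)/(4λ1²) + K1(K2+2)/(4λ1λ2) ], B6 = (1/4)[ (K2/(2λ2))(U²+V²) + (K2²+4K2)/(4λ2²) + K2(K1+2)/(4λ1λ2)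 ]. -/
open MeasureTheory Real

/-- `f` is integrable with integral `c`. -/
def HI {α : Type*} [MeasureSpace α] (f : α → ℝ) (c : ℝ) : Prop :=
  Integrable f volume ∧ ∫ x, f x = c

theorem HI.add {α : Type*} [MeasureSpace α] {f g : α → ℝ} {c d : ℝ} (hf : HI f c) (hg : HI g d) :
    HI (fun x => f x + g x) (c + d) :=
  ⟨hf.1.add hg.1, by rw [integral_add hf.1 hg.1, hf.2, hg.2]⟩

theorem HI.smul {α : Type*} [MeasureSpace α] {f : α → ℝ} {c : ℝ} (a : ℝ) (hf : HI f c) :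
    HI (fun x => a * f x) (a * c) :=
  ⟨hf.1.const_mul a, by rw [integral_const_mul, hf.2]⟩

theorem HI.congr {α : Type*} [MeasureSpace α] {f g : α → ℝ} {c d : ℝ} (hf : HI f c)
    (h : ∀ x, g x = f x) (hc : d = c) : HI g d := by
  have : g = f := funext h
  rw [this, hc]; exact hf

theorem HI.prod {α β : Type*} [MeasureSpace α] [MeasureSpace β]
    [SFinite (volume : Measure α)] [SFinite (volume : Measure β)]
    {f : α → ℝ} {g : β → ℝ} {c d : ℝ} (hf : HI f c) (hg : HI g d) :
    HI (fun x : α × β => f x.1 * g x.2) (c * d) :=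
  ⟨hf.1.mul_prod hg.1, by
    have := integral_prod_mul (μ := (volume : Measure α)) (ν := (volume : Measure β)) f g
    rw [hf.2, hg.2] at this
    exact this⟩

theorem radial_aux (b : ℝ) (hb : 0 < b) (m : ℕ) :
    IntegrableOn (fun y : ℝ => y ^ m * rexp (-b * y ^ 2)) (Set.Ioi 0) ∧
    ∫ y in Set.Ioi (0 : ℝ), y ^ m * rexp (-b * y ^ 2)
      = b ^ (-((m : ℝ) + 1) / 2) * (1 / 2) * Gamma (((m : ℝ) + 1) / 2) := by
  have hm : (-1 : ℝ) < m := by have : (0 : ℝ) ≤ m := m.cast_nonneg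
                               linarith
  have h1 := integrableOn_rpow_mul_exp_neg_mul_rpow hm two_pos hb
  have h2 := integral_rpow_mul_exp_neg_mul_rpow two_pos hm hb
  simp only [rpow_natCast, rpow_two] at h1 h2
  exact ⟨h1, h2⟩

section
variable {E : Type*} [NormedAddCommGroup E] [InnerProductSpace ℝ E] [FiniteDimensional ℝ E]
  [MeasurableSpace E] [BorelSpace E]

theorem radial_integrable (b : ℝ) (hb : 0 < b) (k : ℕ) :
    Integrable (fun x : E => ‖x‖ ^ k * rexp (-b * ‖x‖ ^ 2)) := by
  rcases subsingleton_or_nontrivial E with h | h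
  · have : (fun x : E => ‖x‖ ^ k * rexp (-b * ‖x‖ ^ 2))
        = fun x : E => ‖(0 : E)‖ ^ k * rexp (-b * ‖(0 : E)‖ ^ 2) := by
      funext x; rw [Subsingleton.elim x 0]
    rw [this]
    have : IsFiniteMeasure (volume : Measure E) := by
      constructor
      have hc : IsCompact (Set.univ : Set E) := Set.subsingleton_univ.isCompact
      exact hc.measure_lt_top
    exact integrable_const _
  · refine (integrable_fun_norm_addHaar (volume : Measure E)
      (f := fun y => y ^ k * rexp (-b * y ^ 2))).2 ?_
    have := (radial_aux b hb (Module.finrank ℝ E - 1 + k)).1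
    refine this.congr_fun (fun y _ => ?_) measurableSet_Ioi
    simp only [smul_eq_mul]; rw [pow_add]; ring

theorem radial_rec (b : ℝ) (hb : 0 < b) (k : ℕ) :
    ∫ x : E, ‖x‖ ^ (k + 2) * rexp (-b * ‖x‖ ^ 2)
      = ((Module.finrank ℝ E : ℝ) + k) / (2 * b) * ∫ x : E, ‖x‖ ^ k * rexp (-b * ‖x‖ ^ 2) := by
  rcases subsingleton_or_nontrivial E with h | h
  · have h0 : ∀ x : E, ‖x‖ = 0 := fun x => by rw [Subsingleton.elim x 0, norm_zero]
    have hf : Module.finrank ℝ E = 0 := Module.finrank_zero_of_subsingleton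
    simp only [h0, hf]
    rcases Nat.eq_zero_or_pos k with rfl | hk
    · simp
    · simp [hk.ne']
  · have hn : 0 < Module.finrank ℝ E := Module.finrank_pos
    rw [integral_fun_norm_addHaar (volume : Measure E) (fun y => y ^ (k + 2) * rexp (-b * y ^ 2)),
      integral_fun_norm_addHaar (volume : Measure E) (fun y => y ^ k * rexp (-b * y ^ 2))]
    obtain ⟨n, hn'⟩ : ∃ n, Module.finrank ℝ E = n + 1 := ⟨_, (Nat.succ_pred_eq_of_pos hn).symm⟩
    rw [hn']
    have e : ∀ j : ℕ, ∫ y in Set.Ioi (0 : ℝ), y ^ (n + 1 - 1) • (y ^ j * rexp (-b * y ^ 2))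
        = b ^ (-(((n + j : ℕ) : ℝ) + 1) / 2) * (1 / 2) * Gamma ((((n + j : ℕ) : ℝ) + 1) / 2) := by
      intro j
      rw [← (radial_aux b hb (n + j)).2]
      congr 1
      funext y
      simp only [smul_eq_mul, Nat.add_sub_cancel]; rw [pow_add]; ring
    rw [e, e]
    have h1 : (((n + (k + 2) : ℕ) : ℝ) + 1) / 2 = (((n + k : ℕ) : ℝ) + 1) / 2 + 1 := by
      push_cast; ring
    have h2 : -(((n + (k + 2) : ℕ) : ℝ) + 1) / 2 = -(((n + k : ℕ) : ℝ) + 1) / 2 - 1 := by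
      push_cast; ring
    rw [h1, h2, Gamma_add_one (by positivity), rpow_sub_one hb.ne']
    simp only [nsmul_eq_mul, smul_eq_mul]
    push_cast
    field_simp
    ring
end

/-- Normalised radial moments. -/
noncomputable def emom (K : ℕ) (l : ℝ) : ℕ → ℝ
  | 0 => 1
  | c + 1 => ((K : ℝ) + 2 * c) / (2 * l) * emom K l c

theorem emom_HI (K : ℕ) (l : ℝ) (hl : 0 < l) (c : ℕ) :
    HI (fun x : EuclideanSpace ℝ (Fin K) =>
      (‖x‖ ^ 2) ^ c * ((l / π) ^ ((K : ℝ) / 2) * rexp (-l * ‖x‖ ^ 2))) (emom K l c) := by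
  have key : (fun x : EuclideanSpace ℝ (Fin K) =>
      (‖x‖ ^ 2) ^ c * ((l / π) ^ ((K : ℝ) / 2) * rexp (-l * ‖x‖ ^ 2)))
      = fun x => (l / π) ^ ((K : ℝ) / 2) * (‖x‖ ^ (2 * c) * rexp (-l * ‖x‖ ^ 2)) := by
    funext x; rw [← pow_mul]; ring
  rw [key]
  refine ⟨(radial_integrable l hl _).const_mul _, ?_⟩
  rw [integral_const_mul]
  induction c with
  | zero =>
    simp only [mul_zero, pow_zero, one_mul]
    rw [GaussianFourier.integral_rexp_neg_mul_sq_norm hl, finrank_euclideanSpace_fin,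
      ← mul_rpow (by positivity) (by positivity)]
    have : l / π * (π / l) = 1 := by field_simp
    rw [this, one_rpow]; rfl
  | succ c ih =>
    rw [show 2 * (c + 1) = 2 * c + 2 by ring, radial_rec l hl, emom,
      ← ih (by funext x; rw [← pow_mul]; ring), finrank_euclideanSpace_fin]
    push_cast
    ring

/-- Normalised central Gaussian moments. -/
noncomputable def cm (l : ℝ) : ℕ → ℝ
  | 0 => 1
  | 1 => 0
  | c + 2 => ((c : ℝ) + 1) / (2 * l) * cm l c

theorem cm_HI (l : ℝ) (hl : 0 < l) (c : ℕ) :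
    HI (fun x : ℝ => x ^ c * (√(l / π) * rexp (-l * x ^ 2))) (cm l c) := by
  have ev : ∀ c, HI (fun x : ℝ => x ^ (2 * c) * (√(l / π) * rexp (-l * x ^ 2))) (cm l (2 * c)) := by
    intro c
    have key : (fun x : ℝ => x ^ (2 * c) * (√(l / π) * rexp (-l * x ^ 2)))
        = fun x => √(l / π) * (‖x‖ ^ (2 * c) * rexp (-l * ‖x‖ ^ 2)) := by
      funext x; rw [pow_mul ‖x‖, norm_eq_abs, sq_abs, ← pow_mul]; ring
    rw [key]
    refine ⟨(radial_integrable l hl _).const_mul _, ?_⟩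
    rw [integral_const_mul]
    clear key
    induction c with
    | zero =>
      simp only [mul_zero, pow_zero, one_mul, norm_eq_abs, sq_abs]
      rw [integral_gaussian, ← sqrt_mul (by positivity)]
      have : l / π * (π / l) = 1 := by field_simp
      rw [this, sqrt_one]; rfl
    | succ c ih =>
      rw [show 2 * (c + 1) = 2 * c + 2 by ring, radial_rec l hl, cm, ← ih]
      simp only [Module.finrank_self]
      push_cast
      ring
  rcases Nat.even_or_odd' c with ⟨d, rfl | rfl⟩
  · exact ev d
  · have c0 : cm l (2 * d + 1) = 0 := by
      induction d with
      | zero => rfl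
      | succ d ih => rw [show 2 * (d + 1) + 1 = (2 * d + 1) + 2 by ring, cm, ih, mul_zero]
    rw [c0]
    constructor
    · have := (radial_integrable (E := ℝ) l hl (2 * d + 1)).const_mul (√(l / π))
      refine this.mono (by fun_prop) (Filter.Eventually.of_forall fun x => ?_)
      simp only [norm_mul, norm_pow, norm_eq_abs, sq_abs]
      apply le_of_eq; simp; ring
    · have h := integral_neg_eq_self
        (fun x : ℝ => x ^ (2 * d + 1) * (√(l / π) * rexp (-l * x ^ 2))) volume
      have h' : ∀ x : ℝ, (-x) ^ (2 * d + 1) * (√(l / π) * rexp (-l * (-x) ^ 2))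
          = - (x ^ (2 * d + 1) * (√(l / π) * rexp (-l * x ^ 2))) := by
        intro x; rw [Odd.neg_pow ⟨d, rfl⟩, neg_sq]; ring
      simp only [h', integral_neg] at h
      linarith

theorem cm_shift (l : ℝ) (hl : 0 < l) (U : ℝ) (c : ℕ) :
    HI (fun u : ℝ => (u - U) ^ c * (√(l / π) * rexp (-l * (u - U) ^ 2))) (cm l c) := by
  obtain ⟨h1, h2⟩ := cm_HI l hl c
  exact ⟨h1.comp_sub_right U, by
    rw [← h2]
    exact integral_sub_right_eq_self
      (fun x : ℝ => x ^ c * (√(l / π) * rexp (-l * x ^ 2))) U⟩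

/-- Raw Gaussian moments up to order four, `s` the variance. -/
noncomputable def rm (s U : ℝ) : ℕ → ℝ
  | 0 => 1
  | 1 => U
  | 2 => U ^ 2 + s
  | 3 => U ^ 3 + 3 * U * s
  | _ => U ^ 4 + 6 * U ^ 2 * s + 3 * s ^ 2

theorem rm_HI (l : ℝ) (hl : 0 < l) (U : ℝ) (a : ℕ) (ha : a ≤ 4) :
    HI (fun u : ℝ => u ^ a * (√(l / π) * rexp (-l * (u - U) ^ 2))) (rm (1 / (2 * l)) U a) := by
  have H := cm_shift l hl U
  have h0 := H 0
  have h1 := H 1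
  have h2 := H 2
  have h3 := H 3
  have h4 := H 4
  simp only [cm] at h0 h1 h2 h3 h4
  interval_cases a
  · exact h0.congr (fun x => by ring) (by simp [rm])
  · exact (h1.add (h0.smul U)).congr (fun x => by ring) (by simp [rm])
  · exact (h2.add ((h1.smul (2 * U)).add (h0.smul (U ^ 2)))).congr (fun x => by ring)
      (by simp [rm]; ring)
  · exact (h3.add ((h2.smul (3 * U)).add ((h1.smul (3 * U ^ 2)).add (h0.smul (U ^ 3))))).congr
      (fun x => by ring) (by simp [rm]; ring)
  · exact (h4.add ((h3.smul (4 * U)).add ((h2.smul (6 * U ^ 2)).add ((h1.smul (4 * U ^ 3)).add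
      (h0.smul (U ^ 4)))))).congr
      (fun x => by ring) (by simp [rm]; ring)


/-- The 4×6 moment matrix `M = ∫ ψ ⊗ ψ̃ g dΞ` of the modified equilibrium
distribution equals the explicit matrix given in the paper's appendix. -/
theorem equilibrium_moment_matrix
    (K1 K2 : ℕ) (ρ l1 l2 U V : ℝ) (hρ : 0 < ρ) (hl1 : 0 < l1) (hl2 : 0 < l2)
    (g : ℝ → ℝ → EuclideanSpace ℝ (Fin K1) → EuclideanSpace ℝ (Fin K2) → ℝ)
    (hg : ∀ u v ξ1 ξ2, g u v ξ1 ξ2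
      = ρ * (l1 * l2 / ((l1 + l2) * π)) * (l1 / π) ^ ((K1 : ℝ) / 2)
          * (l2 / π) ^ ((K2 : ℝ) / 2)
          * Real.exp (-(l1 * l2 / (l1 + l2)) * ((u - U) ^ 2 + (v - V) ^ 2)
              - l1 * ‖ξ1‖ ^ 2 - l2 * ‖ξ2‖ ^ 2))
    (ψ : ℝ × ℝ × EuclideanSpace ℝ (Fin K1) × EuclideanSpace ℝ (Fin K2) → Fin 4 → ℝ)
    (hψ : ∀ w, ψ w = ![1, w.1, w.2.1,
        (1 / 2) * (w.1 ^ 2 + w.2.1 ^ 2 + ‖w.2.2.1‖ ^ 2 + ‖w.2.2.2‖ ^ 2)])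
    (ψt : ℝ × ℝ × EuclideanSpace ℝ (Fin K1) × EuclideanSpace ℝ (Fin K2) → Fin 6 → ℝ)
    (hψt : ∀ w, ψt w = ![1, w.1, w.2.1, (1 / 2) * (w.1 ^ 2 + w.2.1 ^ 2),
        (1 / 2) * ‖w.2.2.1‖ ^ 2, (1 / 2) * ‖w.2.2.2‖ ^ 2])
    (B1' B2' B3' B1 B2 B3 B4 B5 B6 : ℝ)
    (hB1' : B1' = (1 / 2) * (U ^ 2 + V ^ 2 + 1 / l1 + 1 / l2))
    (hB2' : B2' = (1 / 2) * U * (U ^ 2 + V ^ 2 + 2 / l1 + 2 / l2))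
    (hB3' : B3' = (1 / 2) * V * (U ^ 2 + V ^ 2 + 2 / l1 + 2 / l2))
    (hB1 : B1 = (1 / 2) * (U ^ 2 + V ^ 2 + ((K1 : ℝ) + 2) / (2 * l1)
        + ((K2 : ℝ) + 2) / (2 * l2)))
    (hB2 : B2 = (1 / 2) * U * (U ^ 2 + V ^ 2 + ((K1 : ℝ) + 4) / (2 * l1)
        + ((K2 : ℝ) + 4) / (2 * l2)))
    (hB3 : B3 = (1 / 2) * V * (U ^ 2 + V ^ 2 + ((K1 : ℝ) + 4) / (2 * l1)
        + ((K2 : ℝ) + 4) / (2 * l2)))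
    (hB4 : B4 = (1 / 4) * ((U ^ 2 + V ^ 2 + 1 / l1 + 1 / l2)
          * (U ^ 2 + V ^ 2 + ((K1 : ℝ) + 2) / (2 * l1) + ((K2 : ℝ) + 2) / (2 * l2))
        + (2 / l1 + 2 / l2) * (U ^ 2 + V ^ 2 + 1 / (2 * l1) + 1 / (2 * l2))))
    (hB5 : B5 = (1 / 4) * (((K1 : ℝ) / (2 * l1)) * (U ^ 2 + V ^ 2)
        + ((K1 : ℝ) ^ 2 + 4 * (K1 : ℝ)) / (4 * l1 ^ 2)
        + (K1 : ℝ) * ((K2 : ℝ) + 2) / (4 * l1 * l2)))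
    (hB6 : B6 = (1 / 4) * (((K2 : ℝ) / (2 * l2)) * (U ^ 2 + V ^ 2)
        + ((K2 : ℝ) ^ 2 + 4 * (K2 : ℝ)) / (4 * l2 ^ 2)
        + (K2 : ℝ) * ((K1 : ℝ) + 2) / (4 * l1 * l2)))
    (M : Matrix (Fin 4) (Fin 6) ℝ)
    (hM : M = ρ • Matrix.of
      ![![1, U, V, B1', (K1 : ℝ) / (4 * l1), (K2 : ℝ) / (4 * l2)],
        ![U, U ^ 2 + 1 / (2 * l1) + 1 / (2 * l2), U * V, B2',
          (K1 : ℝ) * U / (4 * l1), (K2 : ℝ) * U / (4 * l2)],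
        ![V, U * V, V ^ 2 + 1 / (2 * l1) + 1 / (2 * l2), B3',
          (K1 : ℝ) * V / (4 * l1), (K2 : ℝ) * V / (4 * l2)],
        ![B1, B2, B3, B4, B5, B6]]) :
    ∀ (i : Fin 4) (j : Fin 6),
      Integrable (fun w : ℝ × ℝ × EuclideanSpace ℝ (Fin K1) × EuclideanSpace ℝ (Fin K2) =>
        ψ w i * ψt w j * g w.1 w.2.1 w.2.2.1 w.2.2.2) volume
      ∧ ∫ w : ℝ × ℝ × EuclideanSpace ℝ (Fin K1) × EuclideanSpace ℝ (Fin K2),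
          ψ w i * ψt w j * g w.1 w.2.1 w.2.2.1 w.2.2.2 = M i j := by
  have hL : 0 < l1 * l2 / (l1 + l2) := by positivity
  have hs : 1 / (2 * (l1 * l2 / (l1 + l2))) = 1 / (2 * l1) + 1 / (2 * l2) := by
    field_simp
    ring
  have hgw : ∀ w : ℝ × ℝ × EuclideanSpace ℝ (Fin K1) × EuclideanSpace ℝ (Fin K2),
      g w.1 w.2.1 w.2.2.1 w.2.2.2 = ρ * ((√(l1 * l2 / (l1 + l2) / π)
        * rexp (-(l1 * l2 / (l1 + l2)) * (w.1 - U) ^ 2))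
        * ((√(l1 * l2 / (l1 + l2) / π) * rexp (-(l1 * l2 / (l1 + l2)) * (w.2.1 - V) ^ 2))
        * (((l1 / π) ^ ((K1 : ℝ) / 2) * rexp (-l1 * ‖w.2.2.1‖ ^ 2))
        * ((l2 / π) ^ ((K2 : ℝ) / 2) * rexp (-l2 * ‖w.2.2.2‖ ^ 2))))) := by
    intro w
    rw [hg]
    have e1 : l1 * l2 / ((l1 + l2) * π)
        = √(l1 * l2 / (l1 + l2) / π) * √(l1 * l2 / (l1 + l2) / π) := by
      rw [mul_self_sqrt (by positivity), div_div]
    have e2 : -(l1 * l2 / (l1 + l2)) * ((w.1 - U) ^ 2 + (w.2.1 - V) ^ 2)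
              - l1 * ‖w.2.2.1‖ ^ 2 - l2 * ‖w.2.2.2‖ ^ 2
        = -(l1 * l2 / (l1 + l2)) * (w.1 - U) ^ 2 + -(l1 * l2 / (l1 + l2)) * (w.2.1 - V) ^ 2
          + -l1 * ‖w.2.2.1‖ ^ 2 + -l2 * ‖w.2.2.2‖ ^ 2 := by ring
    rw [e1, e2, exp_add, exp_add, exp_add]
    ring
  have H : ∀ a b c d : ℕ, a ≤ 4 → b ≤ 4 →
      HI (fun w : ℝ × ℝ × EuclideanSpace ℝ (Fin K1) × EuclideanSpace ℝ (Fin K2) =>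
        w.1 ^ a * w.2.1 ^ b * (‖w.2.2.1‖ ^ 2) ^ c * (‖w.2.2.2‖ ^ 2) ^ d
          * g w.1 w.2.1 w.2.2.1 w.2.2.2)
        (ρ * (rm (1 / (2 * l1) + 1 / (2 * l2)) U a * (rm (1 / (2 * l1) + 1 / (2 * l2)) V b
          * (emom K1 l1 c * emom K2 l2 d)))) := by
    intro a b c d ha hb
    have h := (((rm_HI _ hL U a ha).prod ((rm_HI _ hL V b hb).prod
      ((emom_HI K1 l1 hl1 c).prod (emom_HI K2 l2 hl2 d)))).smul ρ)
    rw [hs] at h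
    exact h.congr (fun w => by rw [hgw]; ring) rfl
  clear hgw hg
  suffices hmain : ∀ (i : Fin 4) (j : Fin 6),
      HI (fun w : ℝ × ℝ × EuclideanSpace ℝ (Fin K1) × EuclideanSpace ℝ (Fin K2) =>
        ψ w i * ψt w j * g w.1 w.2.1 w.2.2.1 w.2.2.2) (M i j) from hmain
  intro i j
  subst hM hB1' hB2' hB3' hB1 hB2 hB3 hB4 hB5 hB6
  fin_cases i <;> fin_cases j
  · exact (H 0 0 0 0 (by norm_num) (by norm_num)).congr
      (fun w => by simp [hψ, hψt, -mul_eq_mul_right_iff, -mul_eq_mul_left_iff] <;> ring)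
      (by simp [rm, emom, -mul_eq_mul_left_iff, -mul_eq_mul_right_iff] <;> field_simp <;> ring)
  · exact (H 1 0 0 0 (by norm_num) (by norm_num)).congr
      (fun w => by simp [hψ, hψt, -mul_eq_mul_right_iff, -mul_eq_mul_left_iff] <;> ring)
      (by simp [rm, emom, -mul_eq_mul_left_iff, -mul_eq_mul_right_iff] <;> field_simp <;> ring)
  · exact (H 0 1 0 0 (by norm_num) (by norm_num)).congr
      (fun w => by simp [hψ, hψt, -mul_eq_mul_right_iff, -mul_eq_mul_left_iff] <;> ring)
      (by simp [rm, emom, -mul_eq_mul_left_iff, -mul_eq_mul_right_iff] <;> field_simp <;> ring)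
  · exact (((H 2 0 0 0 (by norm_num) (by norm_num)).smul (1 / 2)).add
      ((H 0 2 0 0 (by norm_num) (by norm_num)).smul (1 / 2))).congr
      (fun w => by simp [hψ, hψt, -mul_eq_mul_right_iff, -mul_eq_mul_left_iff] <;> ring)
      (by simp [rm, emom, -mul_eq_mul_left_iff, -mul_eq_mul_right_iff] <;> field_simp <;> ring)
  · exact ((H 0 0 1 0 (by norm_num) (by norm_num)).smul (1 / 2)).congr
      (fun w => by simp [hψ, hψt, -mul_eq_mul_right_iff, -mul_eq_mul_left_iff] <;> ring)
      (by simp [rm, emom, -mul_eq_mul_left_iff, -mul_eq_mul_right_iff] <;> field_simp <;> ring)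
  · exact ((H 0 0 0 1 (by norm_num) (by norm_num)).smul (1 / 2)).congr
      (fun w => by simp [hψ, hψt, -mul_eq_mul_right_iff, -mul_eq_mul_left_iff] <;> ring)
      (by simp [rm, emom, -mul_eq_mul_left_iff, -mul_eq_mul_right_iff] <;> field_simp <;> ring)
  · exact (H 1 0 0 0 (by norm_num) (by norm_num)).congr
      (fun w => by simp [hψ, hψt, -mul_eq_mul_right_iff, -mul_eq_mul_left_iff] <;> ring)
      (by simp [rm, emom, -mul_eq_mul_left_iff, -mul_eq_mul_right_iff] <;> field_simp <;> ring)
  · exact (H 2 0 0 0 (by norm_num) (by norm_num)).congr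
      (fun w => by simp [hψ, hψt, -mul_eq_mul_right_iff, -mul_eq_mul_left_iff] <;> ring)
      (by simp [rm, emom, -mul_eq_mul_left_iff, -mul_eq_mul_right_iff] <;> field_simp <;> ring)
  · exact (H 1 1 0 0 (by norm_num) (by norm_num)).congr
      (fun w => by simp [hψ, hψt, -mul_eq_mul_right_iff, -mul_eq_mul_left_iff] <;> ring)
      (by simp [rm, emom, -mul_eq_mul_left_iff, -mul_eq_mul_right_iff] <;> field_simp <;> ring)
  · exact (((H 3 0 0 0 (by norm_num) (by norm_num)).smul (1 / 2)).add
      ((H 1 2 0 0 (by norm_num) (by norm_num)).smul (1 / 2))).congr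
      (fun w => by simp [hψ, hψt, -mul_eq_mul_right_iff, -mul_eq_mul_left_iff] <;> ring)
      (by simp [rm, emom, -mul_eq_mul_left_iff, -mul_eq_mul_right_iff] <;> field_simp <;> ring)
  · exact ((H 1 0 1 0 (by norm_num) (by norm_num)).smul (1 / 2)).congr
      (fun w => by simp [hψ, hψt, -mul_eq_mul_right_iff, -mul_eq_mul_left_iff] <;> ring)
      (by simp [rm, emom, -mul_eq_mul_left_iff, -mul_eq_mul_right_iff] <;> field_simp <;> ring)
  · exact ((H 1 0 0 1 (by norm_num) (by norm_num)).smul (1 / 2)).congr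
      (fun w => by simp [hψ, hψt, -mul_eq_mul_right_iff, -mul_eq_mul_left_iff] <;> ring)
      (by simp [rm, emom, -mul_eq_mul_left_iff, -mul_eq_mul_right_iff] <;> field_simp <;> ring)
  · exact (H 0 1 0 0 (by norm_num) (by norm_num)).congr
      (fun w => by simp [hψ, hψt, -mul_eq_mul_right_iff, -mul_eq_mul_left_iff] <;> ring)
      (by simp [rm, emom, -mul_eq_mul_left_iff, -mul_eq_mul_right_iff] <;> field_simp <;> ring)
  · exact (H 1 1 0 0 (by norm_num) (by norm_num)).congr
      (fun w => by simp [hψ, hψt, -mul_eq_mul_right_iff, -mul_eq_mul_left_iff] <;> ring)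
      (by simp [rm, emom, -mul_eq_mul_left_iff, -mul_eq_mul_right_iff] <;> field_simp <;> ring)
  · exact (H 0 2 0 0 (by norm_num) (by norm_num)).congr
      (fun w => by simp [hψ, hψt, -mul_eq_mul_right_iff, -mul_eq_mul_left_iff] <;> ring)
      (by simp [rm, emom, -mul_eq_mul_left_iff, -mul_eq_mul_right_iff] <;> field_simp <;> ring)
  · exact (((H 2 1 0 0 (by norm_num) (by norm_num)).smul (1 / 2)).add
      ((H 0 3 0 0 (by norm_num) (by norm_num)).smul (1 / 2))).congr
      (fun w => by simp [hψ, hψt, -mul_eq_mul_right_iff, -mul_eq_mul_left_iff] <;> ring)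
      (by simp [rm, emom, -mul_eq_mul_left_iff, -mul_eq_mul_right_iff] <;> field_simp <;> ring)
  · exact ((H 0 1 1 0 (by norm_num) (by norm_num)).smul (1 / 2)).congr
      (fun w => by simp [hψ, hψt, -mul_eq_mul_right_iff, -mul_eq_mul_left_iff] <;> ring)
      (by simp [rm, emom, -mul_eq_mul_left_iff, -mul_eq_mul_right_iff] <;> field_simp <;> ring)
  · exact ((H 0 1 0 1 (by norm_num) (by norm_num)).smul (1 / 2)).congr
      (fun w => by simp [hψ, hψt, -mul_eq_mul_right_iff, -mul_eq_mul_left_iff] <;> ring)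
      (by simp [rm, emom, -mul_eq_mul_left_iff, -mul_eq_mul_right_iff] <;> field_simp <;> ring)
  · exact (((H 2 0 0 0 (by norm_num) (by norm_num)).smul (1 / 2)).add
      (((H 0 2 0 0 (by norm_num) (by norm_num)).smul (1 / 2)).add
      (((H 0 0 1 0 (by norm_num) (by norm_num)).smul (1 / 2)).add
      ((H 0 0 0 1 (by norm_num) (by norm_num)).smul (1 / 2))))).congr
      (fun w => by simp [hψ, hψt, -mul_eq_mul_right_iff, -mul_eq_mul_left_iff] <;> ring)
      (by simp [rm, emom, -mul_eq_mul_left_iff, -mul_eq_mul_right_iff] <;> field_simp <;> ring)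
  · exact (((H 3 0 0 0 (by norm_num) (by norm_num)).smul (1 / 2)).add
      (((H 1 2 0 0 (by norm_num) (by norm_num)).smul (1 / 2)).add
      (((H 1 0 1 0 (by norm_num) (by norm_num)).smul (1 / 2)).add
      ((H 1 0 0 1 (by norm_num) (by norm_num)).smul (1 / 2))))).congr
      (fun w => by simp [hψ, hψt, -mul_eq_mul_right_iff, -mul_eq_mul_left_iff] <;> ring)
      (by simp [rm, emom, -mul_eq_mul_left_iff, -mul_eq_mul_right_iff] <;> field_simp <;> ring)
  · exact (((H 2 1 0 0 (by norm_num) (by norm_num)).smul (1 / 2)).add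
      (((H 0 3 0 0 (by norm_num) (by norm_num)).smul (1 / 2)).add
      (((H 0 1 1 0 (by norm_num) (by norm_num)).smul (1 / 2)).add
      ((H 0 1 0 1 (by norm_num) (by norm_num)).smul (1 / 2))))).congr
      (fun w => by simp [hψ, hψt, -mul_eq_mul_right_iff, -mul_eq_mul_left_iff] <;> ring)
      (by simp [rm, emom, -mul_eq_mul_left_iff, -mul_eq_mul_right_iff] <;> field_simp <;> ring)
  · exact (((H 4 0 0 0 (by norm_num) (by norm_num)).smul (1 / 4)).add
      (((H 2 2 0 0 (by norm_num) (by norm_num)).smul (1 / 2)).add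
      (((H 0 4 0 0 (by norm_num) (by norm_num)).smul (1 / 4)).add
      (((H 2 0 1 0 (by norm_num) (by norm_num)).smul (1 / 4)).add
      (((H 0 2 1 0 (by norm_num) (by norm_num)).smul (1 / 4)).add
      (((H 2 0 0 1 (by norm_num) (by norm_num)).smul (1 / 4)).add
      ((H 0 2 0 1 (by norm_num) (by norm_num)).smul (1 / 4)))))))).congr
      (fun w => by simp [hψ, hψt, -mul_eq_mul_right_iff, -mul_eq_mul_left_iff] <;> ring)
      (by simp [rm, emom, -mul_eq_mul_left_iff, -mul_eq_mul_right_iff] <;> field_simp <;> ring)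
  · exact (((H 2 0 1 0 (by norm_num) (by norm_num)).smul (1 / 4)).add
      (((H 0 2 1 0 (by norm_num) (by norm_num)).smul (1 / 4)).add
      (((H 0 0 2 0 (by norm_num) (by norm_num)).smul (1 / 4)).add
      ((H 0 0 1 1 (by norm_num) (by norm_num)).smul (1 / 4))))).congr
      (fun w => by simp [hψ, hψt, -mul_eq_mul_right_iff, -mul_eq_mul_left_iff] <;> ring)
      (by simp [rm, emom, -mul_eq_mul_left_iff, -mul_eq_mul_right_iff] <;> field_simp <;> ring)
  · exact (((H 2 0 0 1 (by norm_num) (by norm_num)).smul (1 / 4)).add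
      (((H 0 2 0 1 (by norm_num) (by norm_num)).smul (1 / 4)).add
      (((H 0 0 1 1 (by norm_num) (by norm_num)).smul (1 / 4)).add
      ((H 0 0 0 2 (by norm_num) (by norm_num)).smul (1 / 4))))).congr
      (fun w => by simp [hψ, hψt, -mul_eq_mul_right_iff, -mul_eq_mul_left_iff] <;> ring)
      (by simp [rm, emom, -mul_eq_mul_left_iff, -mul_eq_mul_right_iff] <;> field_simp <;> ring)
end
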